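/- arXiv:2408.08718 — 3 statements merged into one kernel-verified Lean document; each statement's English description precedes it below -/
import Mathlib

section
/- Let g ≥ 1. The homogeneous component of degree g(g−1)/2 of ℛ_g is a one-dimensional ℚ-vector space, and the class of λ_1·λ_2·⋯·λ_{g−1} is a nonzero element, hence a generator, of this component. -/
open MvPolynomial

noncomputable section

/-- The class `λ_m` in `ℚ[λ_1, …, λ_h]`, with the conventions `λ_0 = 1` and
`λ_m = 0` for `m > h`.  Here `λ_m` for `1 ≤ m ≤ h` is the variable `X ⟨m-1⟩`. -/
def lam (h m : ℕ) : MvPolynomial (Fin h) ℚ :=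
  if _h0 : m = 0 then 1
  else if _hm : m ≤ h then X ⟨m - 1, by omega⟩ else 0

/-- The degree-`d` Mumford relation `m_d = Σ_{i+j=d} (−1)^j λ_i λ_j`. -/
def mumford (h d : ℕ) : MvPolynomial (Fin h) ℚ :=
  ∑ i ∈ Finset.range (d + 1), (-1 : MvPolynomial (Fin h) ℚ) ^ (d - i) * lam h i * lam h (d - i)

/-- The Mumford ideal `I_h`, generated by the relations `m_d` for `1 ≤ d ≤ 2h`. -/
def mumfordIdeal (h : ℕ) : Ideal (MvPolynomial (Fin h) ℚ) :=
  Ideal.span (mumford h '' Set.Icc 1 (2 * h))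

/-- `𝒬_h = ℚ[λ_1,…,λ_h]/I_h`. -/
abbrev Qring (h : ℕ) := MvPolynomial (Fin h) ℚ ⧸ mumfordIdeal h

/-- The ideal `I_g + (λ_g)`. -/
def Rideal (g : ℕ) : Ideal (MvPolynomial (Fin g) ℚ) :=
  mumfordIdeal g ⊔ Ideal.span {lam g g}

/-- `ℛ_g = ℚ[λ_1,…,λ_g]/(I_g + (λ_g))`, van der Geer's presentation of the
tautological ring `R*(𝒜_g)`. -/
abbrev Rring (g : ℕ) := MvPolynomial (Fin g) ℚ ⧸ Rideal g

/-- The degree-`k` graded piece of `ℛ_g`, for the grading with `deg λ_i = i`: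
the image of the weighted-homogeneous polynomials of weighted degree `k`. -/
def homogR (g k : ℕ) : Submodule ℚ (Rring g) :=
  Submodule.map (Ideal.Quotient.mkₐ ℚ (Rideal g)).toLinearMap
    (weightedHomogeneousSubmodule ℚ (fun i : Fin g => (i : ℕ) + 1) k)

/-- The degree-`k` graded piece of `𝒬_h`, for the grading with `deg λ_i = i`. -/
def homogQ (h k : ℕ) : Submodule ℚ (Qring h) :=
  Submodule.map (Ideal.Quotient.mkₐ ℚ (mumfordIdeal h)).toLinearMap
    (weightedHomogeneousSubmodule ℚ (fun i : Fin h => (i : ℕ) + 1) k)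

/-- The product of the classes `λ_i` over a multiset of indices. -/
def lamProd (g : ℕ) (s : Multiset ℕ) : MvPolynomial (Fin g) ℚ := (s.map (lam g)).prod

@[simp] lemma lam_zero (g : ℕ) : lam g 0 = 1 := by simp [lam]

lemma lam_of_gt {g m : ℕ} (h : g < m) : lam g m = 0 := by
  rw [lam, dif_neg (by omega), dif_neg (by omega)]

lemma lam_succ {g : ℕ} (i : Fin g) : lam g (i + 1) = X i := by
  rw [lam, dif_neg (by omega), dif_pos (by omega)]
  simp

@[simp] lemma lamProd_cons (g a : ℕ) (s : Multiset ℕ) :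
    lamProd g (a ::ₘ s) = lam g a * lamProd g s := by simp [lamProd]

lemma lamProd_val (g : ℕ) (T : Finset ℕ) : lamProd g T.val = ∏ j ∈ T, lam g j := rfl

lemma isWeightedHomogeneous_lam (g m : ℕ) :
    IsWeightedHomogeneous (fun i : Fin g => (i : ℕ) + 1) (lam g m) m := by
  rcases Nat.eq_zero_or_pos m with rfl | hm
  · simpa using isWeightedHomogeneous_one ℚ (fun i : Fin g => (i : ℕ) + 1)
  · by_cases h : m ≤ g
    · obtain ⟨i, rfl⟩ : ∃ i : Fin g, m = i + 1 := ⟨⟨m - 1, by omega⟩, by simp; omega⟩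
      rw [lam_succ]
      exact isWeightedHomogeneous_X ℚ _ i
    · rw [lam_of_gt (by omega)]
      exact isWeightedHomogeneous_zero ℚ _ _

lemma isWeightedHomogeneous_lamProd (g : ℕ) (s : Multiset ℕ) :
    IsWeightedHomogeneous (fun i : Fin g => (i : ℕ) + 1) (lamProd g s) s.sum := by
  induction s using Multiset.induction with
  | empty => simpa [lamProd] using isWeightedHomogeneous_one ℚ (fun i : Fin g => (i : ℕ) + 1)
  | cons a s ih =>
    rw [lamProd_cons, Multiset.sum_cons]
    exact (isWeightedHomogeneous_lam g a).mul ih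

lemma isWeightedHomogeneous_mumford (g d : ℕ) :
    IsWeightedHomogeneous (fun i : Fin g => (i : ℕ) + 1) (mumford g d) d := by
  refine (weightedHomogeneousSubmodule ℚ _ d).sum_mem fun i hi => ?_
  have hi' : i ≤ d := by simpa [Nat.lt_succ_iff] using hi
  have h := (isWeightedHomogeneous_lam g i).mul (isWeightedHomogeneous_lam g (d - i))
  rw [Nat.add_sub_cancel' hi'] at h
  rw [mul_assoc]
  rcases neg_one_pow_eq_or (MvPolynomial (Fin g) ℚ) (d - i) with h1 | h1
  · rw [h1, one_mul]
    exact h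
  · rw [h1, neg_one_mul]
    exact (weightedHomogeneousSubmodule ℚ _ d).neg_mem h

lemma monomial_eq_lamProd (g : ℕ) (e : Fin g →₀ ℕ) :
    monomial e (1 : ℚ) = lamProd g (e.toMultiset.map fun i : Fin g => (i : ℕ) + 1) := by
  rw [monomial_eq, lamProd, Multiset.map_map, C_1, one_mul]
  have h : (lam g ∘ fun i : Fin g => (i : ℕ) + 1) = X := funext lam_succ
  rw [h, Finsupp.toMultiset_map, Finsupp.prod_toMultiset]
  exact (Finsupp.prod_mapDomain_index (by simp) (by simp [pow_add])).symm

lemma sum_map_toMultiset (g : ℕ) (e : Fin g →₀ ℕ) :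
    (e.toMultiset.map fun i : Fin g => (i : ℕ) + 1).sum =
      Finsupp.weight (fun i : Fin g => (i : ℕ) + 1) e := by
  induction e using Finsupp.induction_linear with
  | zero => simp
  | add e f he hf => simp only [map_add, Multiset.map_add, Multiset.sum_add, he, hf]
  | single i n => simp [Finsupp.weight_apply, Finsupp.toMultiset_single, Multiset.map_nsmul,
      Multiset.sum_nsmul, mul_add]

lemma sum_map_sq_le (s : Multiset ℕ) : (s.map (· ^ 2)).sum ≤ s.sum ^ 2 := by
  induction s using Multiset.induction with
  | empty => simp
  | cons a s ih =>
    simp only [Multiset.map_cons, Multiset.sum_cons]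
    nlinarith [Nat.zero_le (a * s.sum)]

/-- Straightening: modulo `λ_g` and the Mumford relations, every product of `λ`-classes is a
combination of squarefree products of `λ_1, …, λ_{g-1}` of the same degree. -/
theorem lamProd_mem {g : ℕ} {V : Submodule ℚ (MvPolynomial (Fin g) ℚ)} {D : ℕ}
    (squarefree : ∀ T ⊆ Finset.Icc 1 (g - 1), ∑ i ∈ T, i = D → ∏ j ∈ T, lam g j ∈ V)
    (top : ∀ t : Multiset ℕ, g + t.sum = D → lam g g * lamProd g t ∈ V)
    (rel : ∀ (k : ℕ) (t : Multiset ℕ), 1 ≤ k → k < g → 2 * k + t.sum = D →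
      mumford g (2 * k) * lamProd g t ∈ V)
    (s : Multiset ℕ) (hs : s.sum = D) : lamProd g s ∈ V := by
  induction hM : D ^ 2 + Multiset.card s - (s.map (· ^ 2)).sum using Nat.strong_induction_on
    generalizing s with
  | _ M ih =>
    have hle := sum_map_sq_le s
    rw [hs] at hle
    by_cases h0 : 0 ∈ s
    · obtain ⟨t, rfl⟩ := Multiset.exists_cons_of_mem h0
      simp only [Multiset.map_cons, Multiset.sum_cons, Multiset.card_cons] at hM hle hs
      rw [lamProd_cons, lam_zero, one_mul]
      exact ih _ (by simp at hM hle ⊢; omega) t (by omega) rfl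
    by_cases hbig : ∃ a ∈ s, g ≤ a
    · obtain ⟨a, ha, hga⟩ := hbig
      obtain ⟨t, rfl⟩ := Multiset.exists_cons_of_mem ha
      rw [lamProd_cons]
      rcases hga.eq_or_lt with rfl | hlt
      · exact top t (by simpa using hs)
      · rw [lam_of_gt hlt, zero_mul]
        exact V.zero_mem
    push Not at hbig
    by_cases hnd : s.Nodup
    · refine squarefree ⟨s, hnd⟩ (fun a ha => ?_) (by simpa [Finset.sum] using hs)
      have ha' : a ∈ s := ha
      have := hbig a ha'
      have : a ≠ 0 := fun h => h0 (h ▸ ha')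
      rw [Finset.mem_Icc]
      omega
    · rw [Multiset.nodup_iff_le] at hnd
      push Not at hnd
      obtain ⟨k, hk⟩ := hnd
      obtain ⟨t, rfl⟩ := Multiset.le_iff_exists_add.1 hk
      simp only [Multiset.cons_add, zero_add] at *
      have hkg : k < g := hbig k (by simp)
      have hk0 : k ≠ 0 := fun h => h0 (by simp [h])
      simp only [Multiset.map_cons, Multiset.sum_cons, Multiset.card_cons] at hM hle hs
      have hrel := rel k t (by omega) hkg (by omega)
      have hmem : k ∈ Finset.range (2 * k + 1) := by simp; omega
      rw [mumford, ← Finset.add_sum_erase _ _ hmem, add_mul, Finset.sum_mul] at hrel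
      have hsum : ∑ i ∈ (Finset.range (2 * k + 1)).erase k,
          (-1) ^ (2 * k - i) * lam g i * lam g (2 * k - i) * lamProd g t ∈ V := by
        refine V.sum_mem fun i hi => ?_
        rw [Finset.mem_erase, Finset.mem_range] at hi
        have hlt : 2 * k ^ 2 < i ^ 2 + (2 * k - i) ^ 2 := by
          obtain ⟨j, hj⟩ : ∃ j, i + j = 2 * k := ⟨2 * k - i, by omega⟩
          have hj' : 2 * k - i = j := by omega
          rw [hj']
          have hne : (i : ℤ) - k ≠ 0 := by omega
          have := sq_pos_of_ne_zero hne
          have hjz : (j : ℤ) = 2 * k - i := by omega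
          zify
          rw [hjz]
          nlinarith
        have hmemV : lamProd g (i ::ₘ (2 * k - i) ::ₘ t) ∈ V := by
          refine ih _ ?_ _ (by simp; omega) rfl
          have hle' := sum_map_sq_le (i ::ₘ (2 * k - i) ::ₘ t)
          have hsum' : (i ::ₘ (2 * k - i) ::ₘ t).sum = D := by simp; omega
          rw [hsum'] at hle'
          simp only [Multiset.map_cons, Multiset.sum_cons, Multiset.card_cons] at hle' ⊢
          omega
        rw [lamProd_cons, lamProd_cons, ← mul_assoc] at hmemV
        rcases neg_one_pow_eq_or (MvPolynomial (Fin g) ℚ) (2 * k - i) with h1 | h1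
        · rw [h1, one_mul]
          exact hmemV
        · rw [h1, neg_one_mul, neg_mul, neg_mul]
          exact V.neg_mem hmemV
      have hkk := (V.add_mem_iff_left hsum).1 hrel
      have h2 : 2 * k - k = k := by omega
      rw [h2] at hkk
      rw [lamProd_cons, lamProd_cons, ← mul_assoc]
      rcases neg_one_pow_eq_or (MvPolynomial (Fin g) ℚ) k with h1 | h1
      · rwa [h1, one_mul] at hkk
      · rw [h1, neg_one_mul, neg_mul, neg_mul] at hkk
        exact V.neg_mem_iff.1 hkk

/-- The deformed Chern roots: `±1, ±2, …, ±n`, with signs prescribed by `ε`. -/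
def signedRoot {n : ℕ} (ε : Fin n → Bool) (i : Fin n) : ℚ :=
  if ε i then (i : ℚ) + 1 else -((i : ℚ) + 1)

lemma signedRoot_sq {n : ℕ} (ε : Fin n → Bool) (i : Fin n) :
    signedRoot ε i ^ 2 = ((i : ℚ) + 1) ^ 2 := by
  unfold signedRoot
  split_ifs <;> ring

lemma signedRoot_ne_zero {n : ℕ} (ε : Fin n → Bool) (i : Fin n) : signedRoot ε i ≠ 0 := by
  intro h
  have h1 := signedRoot_sq ε i
  rw [h] at h1
  have : (0 : ℚ) < ((i : ℚ) + 1) ^ 2 := by positivity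
  simp at h1
  linarith

lemma signedRoot_add_eq_zero_iff {n : ℕ} (ε δ : Fin n → Bool) (i j : Fin n) :
    signedRoot ε i + signedRoot δ j = 0 ↔ i = j ∧ ε i ≠ δ j := by
  constructor
  · intro h
    have hij : i = j := by
      have h1 := signedRoot_sq ε i
      rw [eq_neg_of_add_eq_zero_left h, neg_sq, signedRoot_sq,
        sq_eq_sq₀ (by positivity) (by positivity)] at h1
      have h2 : (j : ℚ) = i := by linarith
      exact Fin.ext (by exact_mod_cast h2.symm)
    subst hij
    refine ⟨rfl, fun h1 => signedRoot_ne_zero ε i ?_⟩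
    have : signedRoot δ i = signedRoot ε i := by simp [signedRoot, h1]
    linarith
  · rintro ⟨rfl, h⟩
    unfold signedRoot
    cases hε : ε i <;> cases hδ : δ i <;> simp_all

/-- The total Chern polynomial `∏ (1 + x_i t)` of the signed roots. -/
def chernPoly {n : ℕ} (ε : Fin n → Bool) : Polynomial ℚ :=
  ∏ i, (1 + Polynomial.C (signedRoot ε i) * Polynomial.X)

lemma chernPoly_coeff_zero {n : ℕ} (ε : Fin n → Bool) : (chernPoly ε).coeff 0 = 1 := by
  simp [chernPoly, Polynomial.coeff_zero_eq_eval_zero, Polynomial.eval_prod]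

lemma chernPoly_natDegree_le {n : ℕ} (ε : Fin n → Bool) : (chernPoly ε).natDegree ≤ n := by
  refine (Polynomial.natDegree_prod_le _ _).trans ?_
  refine (Finset.sum_le_card_nsmul _ _ 1 fun i _ => ?_).trans (by simp)
  compute_degree

lemma chernPoly_mul_comp_neg {n : ℕ} (ε : Fin n → Bool) :
    chernPoly ε * (chernPoly ε).comp (Polynomial.C (-1) * Polynomial.X) =
      ∏ i : Fin n, (1 - Polynomial.C (((i : ℚ) + 1) ^ 2) * Polynomial.X ^ 2) := by
  rw [chernPoly, Polynomial.prod_comp, ← Finset.prod_mul_distrib]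
  refine Finset.prod_congr rfl fun i _ => ?_
  rw [← signedRoot_sq ε i, Polynomial.C_pow]
  simp only [Polynomial.add_comp, Polynomial.one_comp, Polynomial.mul_comp, Polynomial.C_comp,
    Polynomial.X_comp, Polynomial.C_neg, Polynomial.C_1]
  ring

lemma chernPoly_eval_eq_zero_iff {n : ℕ} (ε δ : Fin n → Bool) (i : Fin n) :
    (chernPoly δ).eval (signedRoot ε i)⁻¹ = 0 ↔ δ i ≠ ε i := by
  have key : ∀ j, (1 + Polynomial.C (signedRoot δ j) * Polynomial.X).eval (signedRoot ε i)⁻¹ = 0 ↔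
      j = i ∧ δ j ≠ ε i := fun j => by
    rw [← signedRoot_add_eq_zero_iff]
    have := signedRoot_ne_zero ε i
    simp only [Polynomial.eval_add, Polynomial.eval_one, Polynomial.eval_mul, Polynomial.eval_C,
      Polynomial.eval_X]
    rw [← div_eq_mul_inv, one_add_div this, div_eq_zero_iff, or_iff_left this, add_comm]
  rw [chernPoly, Polynomial.eval_prod, Finset.prod_eq_zero_iff]
  simp only [key, Finset.mem_univ, true_and, exists_eq_left]

/-- Evaluation of the `λ`-classes at the elementary symmetric functions of all systems of signed
roots. -/
def signEval (g : ℕ) : MvPolynomial (Fin g) ℚ →ₐ[ℚ] ((Fin (g - 1) → Bool) → ℚ) :=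
  aeval fun i ε => (chernPoly ε).coeff (i + 1)

lemma signEval_lam {g : ℕ} (hg : 1 ≤ g) (m : ℕ) (ε : Fin (g - 1) → Bool) :
    signEval g (lam g m) ε = (chernPoly ε).coeff m := by
  rcases Nat.eq_zero_or_pos m with rfl | hm
  · simp [chernPoly_coeff_zero]
  · by_cases h : m ≤ g
    · obtain ⟨i, rfl⟩ : ∃ i : Fin g, m = i + 1 := ⟨⟨m - 1, by omega⟩, by simp; omega⟩
      rw [lam_succ, signEval, aeval_X]
    · rw [lam_of_gt (by omega), map_zero, Pi.zero_apply, Polynomial.coeff_eq_zero_of_natDegree_lt]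
      have := chernPoly_natDegree_le ε
      omega

lemma signEval_lam_self {g : ℕ} (hg : 1 ≤ g) : signEval g (lam g g) = 0 := by
  funext ε
  rw [signEval_lam hg, Pi.zero_apply, Polynomial.coeff_eq_zero_of_natDegree_lt]
  have := chernPoly_natDegree_le ε
  omega

lemma exists_signEval_mumford {g : ℕ} (hg : 1 ≤ g) (d : ℕ) :
    ∃ c : ℚ, ∀ f, signEval g (mumford g d * f) = c • signEval g f := by
  refine ⟨(∏ i : Fin (g - 1),
    (1 - Polynomial.C (((i : ℚ) + 1) ^ 2) * Polynomial.X ^ 2)).coeff d, fun f => ?_⟩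
  funext ε
  rw [map_mul, Pi.mul_apply, Pi.smul_apply, smul_eq_mul]
  congr 1
  rw [← chernPoly_mul_comp_neg ε, Polynomial.coeff_mul,
    Finset.Nat.sum_antidiagonal_eq_sum_range_succ_mk, mumford, map_sum, Finset.sum_apply]
  refine Finset.sum_congr rfl fun i _ => ?_
  rw [Polynomial.comp_C_mul_X_coeff]
  simp only [map_mul, map_pow, map_neg, map_one, Pi.mul_apply, Pi.pow_apply, Pi.neg_apply,
    Pi.one_apply, signEval_lam hg]
  ring

lemma signEval_surjective {g : ℕ} (hg : 1 ≤ g) : Function.Surjective (signEval g) := by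
  have hlin : ∀ a : ℚ, ∃ f, ∀ ε, signEval g f ε = (chernPoly ε).eval a := fun a => by
    refine ⟨∑ m ∈ Finset.range g, a ^ m • lam g m, fun ε => ?_⟩
    have h := chernPoly_natDegree_le ε
    rw [Polynomial.eval_eq_sum_range' (n := g) (by omega)]
    simp [map_sum, Finset.sum_apply, signEval_lam hg, mul_comm]
  choose F hF using hlin
  let G : (Fin (g - 1) → Bool) → MvPolynomial (Fin g) ℚ := fun ε => ∏ i, F (signedRoot ε i)⁻¹
  have hG : ∀ ε δ, signEval g (G ε) δ = 0 ↔ δ ≠ ε := fun ε δ => by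
    simp only [G, map_prod, Finset.prod_apply, hF, Finset.prod_eq_zero_iff, Finset.mem_univ,
      true_and, chernPoly_eval_eq_zero_iff]
    exact Function.ne_iff.symm
  intro v
  refine ⟨∑ ε, (v ε / signEval g (G ε) ε) • G ε, ?_⟩
  funext δ
  rw [map_sum, Finset.sum_apply, Finset.sum_eq_single δ]
  · have : signEval g (G δ) δ ≠ 0 := fun h => (hG δ δ).1 h rfl
    simp [this]
  · intro ε _ hε
    simp [(hG ε δ).2 hε.symm]
  · simp

/-- A product of `λ`-classes of degree `D` evaluates to a combination of squarefree products of
degree at most `D`. -/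
lemma signEval_lamProd_mem {g : ℕ} (hg : 1 ≤ g) (s : Multiset ℕ) :
    signEval g (lamProd g s) ∈ Submodule.span ℚ ((fun T => signEval g (∏ j ∈ T, lam g j)) ''
      {T | T ⊆ Finset.Icc 1 (g - 1) ∧ ∑ i ∈ T, i ≤ s.sum}) := by
  induction hD : s.sum using Nat.strong_induction_on generalizing s with
  | _ D ih =>
    refine lamProd_mem (V := (Submodule.span ℚ ((fun T => signEval g (∏ j ∈ T, lam g j)) ''
      {T | T ⊆ Finset.Icc 1 (g - 1) ∧ ∑ i ∈ T, i ≤ D})).comap (signEval g).toLinearMap)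
      ?_ ?_ ?_ s hD
    · exact fun T hT h => Submodule.subset_span ⟨T, ⟨hT, h.le⟩, rfl⟩
    · intro t _
      simp [signEval_lam_self hg]
    · intro k t hk _ ht
      obtain ⟨c, hc⟩ := exists_signEval_mumford hg (2 * k)
      rw [Submodule.mem_comap, AlgHom.toLinearMap_apply, hc]
      refine Submodule.smul_mem _ _ (Submodule.span_mono (Set.image_mono ?_)
        (ih t.sum (by omega) t rfl))
      exact fun T hT => ⟨hT.1, hT.2.trans (by omega)⟩

lemma lamProd_mem_imp {g : ℕ} {V : Submodule ℚ (MvPolynomial (Fin g) ℚ)}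
    (h : ∀ s, lamProd g s ∈ V) (f : MvPolynomial (Fin g) ℚ) : f ∈ V := by
  rw [f.as_sum]
  refine V.sum_mem fun e _ => ?_
  rw [← mul_one (coeff e f), ← smul_eq_mul, ← smul_monomial, monomial_eq_lamProd]
  exact V.smul_mem _ (h _)

/-- The full product `λ_1 ⋯ λ_{g-1}` is not, after evaluation, a combination of the other
squarefree products. -/
lemma signEval_prod_notMem_span {g : ℕ} (hg : 1 ≤ g) :
    signEval g (∏ j ∈ Finset.Icc 1 (g - 1), lam g j) ∉
      Submodule.span ℚ ((fun T => signEval g (∏ j ∈ T, lam g j)) ''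
        ((Finset.Icc 1 (g - 1)).powerset.erase (Finset.Icc 1 (g - 1)) : Set (Finset ℕ))) := by
  classical
  intro hmem
  set W := Submodule.span ℚ ((fun T => signEval g (∏ j ∈ T, lam g j)) ''
        ((Finset.Icc 1 (g - 1)).powerset.erase (Finset.Icc 1 (g - 1)) : Set (Finset ℕ))) with hW
  have htop : W = ⊤ := by
    rw [eq_top_iff]
    rintro v -
    obtain ⟨f, rfl⟩ := signEval_surjective hg v
    refine lamProd_mem_imp (V := W.comap (signEval g).toLinearMap) (fun s => ?_) f
    rw [Submodule.mem_comap, AlgHom.toLinearMap_apply]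
    refine (Submodule.span_le (p := W)).2 ?_ (signEval_lamProd_mem hg s)
    rintro _ ⟨T, ⟨hT, -⟩, rfl⟩
    by_cases h : T = Finset.Icc 1 (g - 1)
    · rw [h]
      exact hmem
    · exact Submodule.subset_span ⟨T, Finset.mem_erase.2 ⟨h, Finset.mem_powerset.2 hT⟩, rfl⟩
  have hcard := finrank_span_finset_le_card (R := ℚ)
    (((Finset.Icc 1 (g - 1)).powerset.erase (Finset.Icc 1 (g - 1))).image
      fun T => signEval g (∏ j ∈ T, lam g j))
  rw [Set.finrank, Finset.coe_image, ← hW, htop, finrank_top, Module.finrank_pi] at hcard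
  have hle := hcard.trans Finset.card_image_le
  rw [Finset.card_erase_of_mem (by simp), Finset.card_powerset, Nat.card_Icc] at hle
  have := Nat.two_pow_pos (g - 1)
  simp at hle
  omega

lemma sum_Icc_one_pred (g : ℕ) : ∑ i ∈ Finset.Icc 1 (g - 1), i = g * (g - 1) / 2 := by
  rw [← Finset.sum_range_id]
  refine Finset.sum_subset (fun i hi => ?_) (fun i hi h => ?_)
  · simp only [Finset.mem_Icc, Finset.mem_range] at *
    omega
  · simp only [Finset.mem_Icc, Finset.mem_range] at *
    omega

lemma eq_of_subset_of_sum_eq {g : ℕ} {T : Finset ℕ} (hT : T ⊆ Finset.Icc 1 (g - 1))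
    (h : ∑ i ∈ Finset.Icc 1 (g - 1), i ≤ ∑ i ∈ T, i) : T = Finset.Icc 1 (g - 1) := by
  by_contra hne
  obtain ⟨a, ha, haT⟩ := Finset.exists_of_ssubset (hT.ssubset_of_ne hne)
  refine h.not_gt (Finset.sum_lt_sum_of_subset hT ha haT ?_ fun _ _ _ => Nat.zero_le _)
  exact (Finset.mem_Icc.1 ha).1

theorem prod_lam_notMem_Rideal {g : ℕ} (hg : 1 ≤ g) :
    ∏ j ∈ Finset.Icc 1 (g - 1), lam g j ∉ Rideal g := by
  obtain ⟨φ, hφ, hker⟩ := Submodule.exists_le_ker_of_notMem (signEval_prod_notMem_span hg)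
  let w : Fin g → ℕ := fun i => (i : ℕ) + 1
  set N := ∑ i ∈ Finset.Icc 1 (g - 1), i with hN
  let Φ : MvPolynomial (Fin g) ℚ →ₗ[ℚ] ℚ :=
    φ ∘ₗ (signEval g).toLinearMap ∘ₗ weightedHomogeneousComponent w N
  have hlow : ∀ s : Multiset ℕ, s.sum < N → φ (signEval g (lamProd g s)) = 0 := fun s hs => by
    refine (Submodule.span_le.2 ?_ (signEval_lamProd_mem hg s) : _ ∈ LinearMap.ker φ)
    rintro _ ⟨T, ⟨hT, hTs⟩, rfl⟩
    refine hker (Submodule.subset_span ⟨T, ?_, rfl⟩)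
    have : T ≠ Finset.Icc 1 (g - 1) := by
      rintro rfl
      omega
    exact Finset.mem_erase.2 ⟨this, Finset.mem_powerset.2 hT⟩
  have hΦ : ∀ f d, IsWeightedHomogeneous w f d → Φ f = if d = N then φ (signEval g f) else 0 := by
    intro f d hf
    split_ifs with h
    · subst h
      simp [Φ, hf.weightedHomogeneousComponent_same]
    · simp [Φ, hf.weightedHomogeneousComponent_ne N (Ne.symm h)]
  have hgen : ∀ x d, IsWeightedHomogeneous w x d →
      (∀ s : Multiset ℕ, d + s.sum = N → φ (signEval g (x * lamProd g s)) = 0) →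
      ∀ f, Φ (f * x) = 0 := by
    intro x d hx h f
    refine lamProd_mem_imp (V := LinearMap.ker (Φ ∘ₗ LinearMap.mulRight ℚ x)) (fun s => ?_) f
    rw [LinearMap.mem_ker, LinearMap.comp_apply, LinearMap.mulRight_apply, mul_comm,
      hΦ _ _ (hx.mul (isWeightedHomogeneous_lamProd g s))]
    split_ifs with hd
    · exact h s hd
    · rfl
  let J : Ideal (MvPolynomial (Fin g) ℚ) :=
    { carrier := {x | ∀ f, Φ (f * x) = 0}
      add_mem' := fun ha hb f => by rw [mul_add, map_add, ha, hb, add_zero]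
      zero_mem' := fun f => by rw [mul_zero, map_zero]
      smul_mem' := fun c x hx f => by rw [smul_eq_mul, ← mul_assoc]; exact hx _ }
  have hJ : Rideal g ≤ J := by
    refine sup_le (Ideal.span_le.2 ?_) (Ideal.span_le.2 ?_)
    · rintro _ ⟨d, hd, rfl⟩
      refine hgen _ d (isWeightedHomogeneous_mumford g d) fun s hs => ?_
      obtain ⟨c, hc⟩ := exists_signEval_mumford hg d
      have := hd.1
      rw [hc, map_smul, hlow s (by omega), smul_zero]
    · rintro _ rfl
      refine hgen _ g (isWeightedHomogeneous_lam g g) fun s _ => ?_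
      rw [map_mul, signEval_lam_self hg, zero_mul, map_zero]
  intro hmem
  have h1 := hJ hmem 1
  rw [one_mul, ← lamProd_val, hΦ _ _ (isWeightedHomogeneous_lamProd g _)] at h1
  rw [if_pos (by rw [hN, Finset.sum, Multiset.map_id'])] at h1
  exact hφ h1

lemma homogR_eq_span {g : ℕ} : homogR g (g * (g - 1) / 2) =
    Submodule.span ℚ {Ideal.Quotient.mk (Rideal g) (∏ j ∈ Finset.Icc 1 (g - 1), lam g j)} := by
  set v := Ideal.Quotient.mk (Rideal g) (∏ j ∈ Finset.Icc 1 (g - 1), lam g j) with hv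
  have hstraight : ∀ s : Multiset ℕ, s.sum = g * (g - 1) / 2 →
      lamProd g s ∈ (Submodule.span ℚ {v}).comap (Ideal.Quotient.mkₐ ℚ (Rideal g)).toLinearMap := by
    have hzero : ∀ x ∈ Rideal g, ∀ y, x * y ∈
        (Submodule.span ℚ {v}).comap (Ideal.Quotient.mkₐ ℚ (Rideal g)).toLinearMap := by
      intro x hx y
      have h0 : Ideal.Quotient.mkₐ ℚ (Rideal g) (x * y) = 0 :=
        Ideal.Quotient.eq_zero_iff_mem.2 (Ideal.mul_mem_right _ _ hx)
      rw [Submodule.mem_comap, AlgHom.toLinearMap_apply, h0]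
      exact Submodule.zero_mem _
    refine lamProd_mem (fun T hT hsum => ?_) (fun t _ => hzero _ ?_ _)
      (fun k t hk hkg _ => hzero _ ?_ _)
    · rw [eq_of_subset_of_sum_eq hT (by rw [sum_Icc_one_pred, hsum])]
      exact Submodule.mem_span_singleton_self v
    · exact Submodule.mem_sup_right (Ideal.subset_span rfl)
    · refine Submodule.mem_sup_left (Ideal.subset_span ⟨2 * k, ⟨by omega, by omega⟩, rfl⟩)
  apply le_antisymm
  · rw [homogR, Submodule.map_le_iff_le_comap]
    intro f hf
    rw [f.as_sum]
    refine Submodule.sum_mem _ fun e he => ?_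
    rw [← mul_one (coeff e f), ← smul_eq_mul, ← smul_monomial, monomial_eq_lamProd]
    refine Submodule.smul_mem _ _ (hstraight _ ?_)
    rw [sum_map_toMultiset]
    exact hf (mem_support_iff.1 he)
  · rw [Submodule.span_singleton_le_iff_mem]
    refine ⟨_, ?_, rfl⟩
    have h := isWeightedHomogeneous_lamProd g (Finset.Icc 1 (g - 1)).val
    rwa [show (Finset.Icc 1 (g - 1)).val.sum = g * (g - 1) / 2 by
      rw [← sum_Icc_one_pred, Finset.sum, Multiset.map_id']] at h

/-- **The socle of ℛ_g (van der Geer).**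
For `g ≥ 1`, the degree-`g(g−1)/2` graded piece of `ℛ_g` is a one-dimensional
`ℚ`-vector space, and the class of `λ_1 λ_2 ⋯ λ_{g−1}` is a nonzero element of it,
hence a generator. -/
theorem Rring_socle (g : ℕ) (hg : 1 ≤ g) :
    Module.finrank ℚ (homogR g (g * (g - 1) / 2)) = 1 ∧
    Ideal.Quotient.mk (Rideal g) (∏ j ∈ Finset.Icc 1 (g - 1), lam g j) ∈
      homogR g (g * (g - 1) / 2) ∧
    Ideal.Quotient.mk (Rideal g) (∏ j ∈ Finset.Icc 1 (g - 1), lam g j) ≠ 0 ∧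
    (∀ x ∈ homogR g (g * (g - 1) / 2), ∃ c : ℚ,
      x = c • Ideal.Quotient.mk (Rideal g) (∏ j ∈ Finset.Icc 1 (g - 1), lam g j)) := by
  have hne : Ideal.Quotient.mk (Rideal g) (∏ j ∈ Finset.Icc 1 (g - 1), lam g j) ≠ 0 :=
    fun h => prod_lam_notMem_Rideal hg (Ideal.Quotient.eq_zero_iff_mem.1 h)
  rw [homogR_eq_span]
  refine ⟨finrank_span_singleton hne, Submodule.mem_span_singleton_self _, hne, fun x hx => ?_⟩
  obtain ⟨c, rfl⟩ := Submodule.mem_span_singleton.1 hx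
  exact ⟨c, rfl⟩

end
end

section
/- Let g ≥ 1 and let 0 ≤ k ≤ g(g−1)/2. The bilinear multiplication pairing from (degree-k part of ℛ_g) × (degree-(g(g−1)/2 − k) part of ℛ_g) to the degree-g(g−1)/2 part of ℛ_g (which is isomorphic to ℚ) is perfect: for every nonzero homogeneous x ∈ ℛ_g of degree k there exists a homogeneous y ∈ ℛ_g of degree g(g−1)/2 − k with x·y ≠ 0, and symmetrically. In other words, ℛ_g is a Gorenstein graded ℚ-algebra with socle in degree g(g−1)/2. -/
open MvPolynomial

noncomputable section

section Combinatorics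

lemma card_filter_le_add (h : ℕ) (k : Fin h) :
    (Finset.univ.filter fun i : Fin h => h ≤ k + 1 + i).card = k + 1 := by
  have hk := k.isLt
  have : (Finset.univ.filter fun i : Fin h => h ≤ k + 1 + i)
      = Finset.Ici (⟨h - 1 - k, by omega⟩ : Fin h) := by
    ext i
    simp only [Finset.mem_filter, Finset.mem_univ, true_and, Finset.mem_Ici, Fin.le_def]
    omega
  rw [this, Fin.card_Ici]
  simp only
  omega

/-- A family of subsets of sizes `1, …, h` whose column counts are `2 * σ j + 1 - j` forces the
permutation `σ` to be trivial. -/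
lemma perm_eq_one_of_card_filter {h : ℕ} (σ : Equiv.Perm (Fin h)) (p : Fin h → Finset (Fin h))
    (hp : ∀ k, (p k).card = k + 1)
    (hσ : ∀ j, 2 * (σ j : ℕ) + 1 = j + (Finset.univ.filter fun k => j ∈ p k).card) :
    σ = 1 := by
  suffices H : ∀ j : Fin h, σ j = j ∧ ∀ k : Fin h, h ≤ k + 1 + j → j ∈ p k from
    Equiv.ext fun j => (H j).1
  intro j
  induction j using WellFoundedGT.induction with
  | ind j ih =>
    have key : ∀ k : Fin h, k + 1 + (j : ℕ) < h →
        (Finset.univ.filter fun i : Fin h => h ≤ k + 1 + i) = p k := by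
      intro k hk
      apply Finset.eq_of_subset_of_card_le
      · intro i hi
        simp only [Finset.mem_filter, Finset.mem_univ, true_and] at hi
        exact (ih i (Fin.lt_def.2 (by omega))).2 k hi
      · rw [hp, card_filter_le_add]
    have sub : ∀ i ≤ j, (Finset.univ.filter fun k => i ∈ p k) ⊆
        Finset.univ.filter fun k : Fin h => h ≤ j + 1 + k := by
      intro i hi k hk
      simp only [Finset.mem_filter, Finset.mem_univ, true_and] at hk ⊢
      by_contra hlt
      rw [← key k (by omega)] at hk
      simp only [Finset.mem_filter, Finset.mem_univ, true_and] at hk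
      rw [Fin.le_def] at hi
      omega
    have hσj : σ j = j := by
      obtain ⟨i, hi⟩ := σ.surjective j
      have hij : i ≤ j := by
        by_contra hlt
        have := (ih i (not_le.1 hlt)).1
        rw [hi] at this
        exact hlt this.ge
      have hc := Finset.card_le_card (sub i hij)
      rw [card_filter_le_add] at hc
      have h1 := hσ i
      rw [hi] at h1
      have : i = j := by
        rw [Fin.le_def] at hij
        ext
        omega
      rwa [this] at hi
    refine ⟨hσj, fun k hk => ?_⟩
    have h1 := hσ j
    rw [hσj] at h1
    have heq := Finset.eq_of_subset_of_card_le (sub j le_rfl) (by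
      rw [card_filter_le_add]; omega)
    have : k ∈ Finset.univ.filter fun k : Fin h => h ≤ j + 1 + k := by
      simp only [Finset.mem_filter, Finset.mem_univ, true_and]
      omega
    rw [← heq] at this
    simpa using this

lemma sum_sign_mul_comp_eq_zero {ι α : Type*} [Fintype ι] [DecidableEq ι] (c : (ι → α) → ℚ)
    (a : ι → α) {p q : ι} (hpq : p ≠ q) (ha : a p = a q) :
    ∑ σ : Equiv.Perm ι, ((Equiv.Perm.sign σ : ℤ) : ℚ) * c (a ∘ σ) = 0 := by
  have hswap : a ∘ Equiv.swap p q = a := by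
    ext i
    simp only [Function.comp_apply, Equiv.swap_apply_def]
    split_ifs <;> simp_all
  have := Equiv.sum_comp (Equiv.mulLeft (Equiv.swap p q))
    fun σ : Equiv.Perm ι => ((Equiv.Perm.sign σ : ℤ) : ℚ) * c (a ∘ σ)
  simp only [Equiv.coe_mulLeft, Equiv.Perm.sign_mul, Equiv.Perm.sign_swap hpq, Equiv.Perm.coe_mul,
    ← Function.comp_assoc, hswap] at this
  simp only [neg_mul, one_mul, Units.val_neg, Int.cast_neg, Finset.sum_neg_distrib] at this
  linarith

end Combinatorics

section Functional

/-- The signed sum of the coefficients of `F` at the permutations of the exponent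
`(1, 3, 5, …)`. -/
def altCoeff (h : ℕ) : MvPolynomial (Fin h) ℚ →ₗ[ℚ] ℚ :=
  ∑ σ : Equiv.Perm (Fin h), ((Equiv.Perm.sign σ : ℤ) : ℚ) •
    lcoeff ℚ (Finsupp.equivFunOnFinite.symm fun j => 2 * (σ j : ℕ) + 1)

lemma altCoeff_apply (h : ℕ) (F : MvPolynomial (Fin h) ℚ) :
    altCoeff h F = ∑ σ : Equiv.Perm (Fin h), ((Equiv.Perm.sign σ : ℤ) : ℚ) *
      coeff (Finsupp.equivFunOnFinite.symm fun j => 2 * (σ j : ℕ) + 1) F := by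
  simp [altCoeff]

lemma prod_X_pow_eq_monomial_indicator {h : ℕ} (T : Finset (Fin h)) (n : ℕ) :
    ∏ t ∈ T, (X t : MvPolynomial (Fin h) ℚ) ^ n =
      monomial (Finsupp.equivFunOnFinite.symm fun j => if j ∈ T then n else 0) 1 := by
  rw [monomial_eq, Finsupp.prod_fintype _ _ (by simp)]
  simp [Finset.prod_ite_mem, pow_ite]

lemma altCoeff_sum_prod_sq_mul {h : ℕ} (w : ℕ → ℚ) (hw : w 0 = 0) (G : MvPolynomial (Fin h) ℚ) :
    altCoeff h ((∑ T : Finset (Fin h), C (w T.card) * ∏ t ∈ T, X t ^ 2) * G) = 0 := by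
  have reindex : ∀ σ : Equiv.Perm (Fin h),
      ∑ T : Finset (Fin h), C (w T.card) * ∏ t ∈ T, (X t : MvPolynomial (Fin h) ℚ) ^ 2 =
      ∑ U : Finset (Fin h), C (w U.card) *
        ∏ t ∈ U.map σ.symm.toEmbedding, (X t : MvPolynomial (Fin h) ℚ) ^ 2 := by
    intro σ
    rw [← Equiv.sum_comp (Equiv.finsetCongr σ.symm)]
    simp [Equiv.finsetCongr_apply, Finset.card_map]
  rw [altCoeff_apply]
  have : ∀ σ : Equiv.Perm (Fin h), ((Equiv.Perm.sign σ : ℤ) : ℚ) *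
      coeff (Finsupp.equivFunOnFinite.symm fun j => 2 * (σ j : ℕ) + 1)
        ((∑ T : Finset (Fin h), C (w T.card) * ∏ t ∈ T, X t ^ 2) * G) =
      ∑ U : Finset (Fin h), w U.card * (((Equiv.Perm.sign σ : ℤ) : ℚ) *
        coeff (Finsupp.equivFunOnFinite.symm fun j => 2 * (σ j : ℕ) + 1)
          ((∏ t ∈ U.map σ.symm.toEmbedding, X t ^ 2) * G)) := by
    intro σ
    rw [reindex σ, Finset.sum_mul, coeff_sum, Finset.mul_sum]
    refine Finset.sum_congr rfl fun U _ => ?_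
    rw [mul_assoc, coeff_C_mul]
    ring
  rw [Finset.sum_congr rfl fun σ _ => this σ, Finset.sum_comm]
  refine Finset.sum_eq_zero fun U _ => ?_
  rw [← Finset.mul_sum]
  rcases U.eq_empty_or_nonempty with rfl | hU
  · simp [hw]
  refine mul_eq_zero_of_right _ ?_
  simp only [prod_X_pow_eq_monomial_indicator, Finset.mem_map_equiv, Equiv.symm_symm,
    coeff_monomial_mul', one_mul]
  set u := U.min' hU with hu
  have huU : u ∈ U := U.min'_mem hU
  by_cases hu0 : (u : ℕ) = 0
  · refine Finset.sum_eq_zero fun σ _ => ?_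
    rw [if_neg, mul_zero]
    intro hle
    have := hle (σ.symm u)
    simp [huU, hu0] at this
  · let v : Fin h := ⟨u - 1, by omega⟩
    have hv : v ∉ U := fun hv => by
      have := U.min'_le v hv
      rw [← hu, Fin.le_def] at this
      simp only [v] at this
      omega
    have hpos : ∀ i ∈ U, 1 ≤ (i : ℕ) := fun i hi => by
      have := U.min'_le i hi
      rw [← hu, Fin.le_def] at this
      omega
    rw [← sum_sign_mul_comp_eq_zero (fun e => coeff (Finsupp.equivFunOnFinite.symm e) G)
      (fun i : Fin h => 2 * (i : ℕ) + 1 - if i ∈ U then 2 else 0) (p := u) (q := v)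
      (fun huv => hv (huv ▸ huU)) (by simp only [huU, hv, if_true, if_false, v]; omega)]
    refine Finset.sum_congr rfl fun σ _ => ?_
    rw [if_pos]
    · congr 2
      ext j
      simp
    · intro j
      simp only [Finsupp.equivFunOnFinite_symm_apply_apply]
      split_ifs with hj
      · have := hpos _ hj
        omega
      · omega

lemma altCoeff_prod_esymm_ne_zero (h : ℕ) :
    altCoeff h ((∏ k : Fin h, esymm (Fin h) ℚ (k + 1)) * ∏ j : Fin h, X j ^ (j : ℕ)) ≠ 0 := by
  have expand : (∏ k : Fin h, esymm (Fin h) ℚ (k + 1)) * ∏ j : Fin h, X j ^ (j : ℕ) =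
      ∑ p ∈ Fintype.piFinset fun k : Fin h => Finset.univ.powersetCard ((k : ℕ) + 1),
        monomial (Finsupp.equivFunOnFinite.symm fun j : Fin h =>
          (j : ℕ) + (Finset.univ.filter fun k => j ∈ p k).card) (1 : ℚ) := by
    simp only [esymm]
    rw [Finset.prod_univ_sum, Finset.sum_mul]
    refine Finset.sum_congr rfl fun p _ => ?_
    rw [monomial_eq, Finsupp.prod_fintype _ _ (by simp)]
    simp only [Finsupp.equivFunOnFinite_symm_apply_apply, pow_add, Finset.prod_mul_distrib, map_one,
      one_mul]
    rw [mul_comm]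
    congr 1
    calc ∏ k, ∏ i ∈ p k, (X i : MvPolynomial (Fin h) ℚ)
        = ∏ k, ∏ i, if i ∈ p k then (X i : MvPolynomial (Fin h) ℚ) else 1 := by
          simp [Finset.prod_ite_mem]
      _ = _ := by
          rw [Finset.prod_comm]
          simp [Finset.prod_ite]
  rw [expand, altCoeff_apply, Finset.sum_eq_single 1]
  · simp only [coeff_sum, coeff_monomial, Equiv.Perm.sign_one, Units.val_one, Int.cast_one, one_mul,
      Equiv.Perm.coe_one, id_eq]
    apply ne_of_gt
    apply Finset.sum_pos'
    · intro p _
      split_ifs <;> norm_num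
    · refine ⟨fun k => Finset.univ.filter fun i : Fin h => h ≤ k + 1 + i, ?_, ?_⟩
      · simp only [Fintype.mem_piFinset, Finset.mem_powersetCard_univ]
        exact card_filter_le_add h
      · rw [if_pos]
        · norm_num
        · ext j
          have := card_filter_le_add h j
          simp only [Finsupp.equivFunOnFinite_symm_apply_apply, Finset.mem_filter, Finset.mem_univ,
            true_and]
          simp only [add_right_comm _ 1, add_comm _ (j : ℕ)] at this ⊢
          omega
  · intro σ _ hσ
    refine mul_eq_zero_of_right _ ?_
    rw [coeff_sum]
    refine Finset.sum_eq_zero fun p hp => ?_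
    rw [coeff_monomial, if_neg]
    intro he
    refine hσ (perm_eq_one_of_card_filter σ p ?_ fun j => ?_)
    · simpa only [Fintype.mem_piFinset, Finset.mem_powersetCard_univ] using hp
    · simpa using (DFunLike.congr_fun he j).symm
  · simp

end Functional

section Evaluation

/-- The substitution `λ_i ↦ e_i(x_1, …, x_h)`. -/
def toEsymm (g h : ℕ) : MvPolynomial (Fin g) ℚ →ₐ[ℚ] MvPolynomial (Fin h) ℚ :=
  aeval fun i => esymm (Fin h) ℚ (i + 1)

lemma esymm_eq_zero_of_lt {h m : ℕ} (hm : h < m) : esymm (Fin h) ℚ m = 0 := by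
  rw [esymm, Finset.powersetCard_eq_empty.2 (by simpa using hm), Finset.sum_empty]

lemma toEsymm_lam {g h : ℕ} (hgh : h ≤ g) (m : ℕ) :
    toEsymm g h (lam g m) = esymm (Fin h) ℚ m := by
  unfold lam
  split_ifs with h0 hm
  · simp [h0, esymm_zero]
  · rw [toEsymm, aeval_X]
    congr 1
    simp only
    omega
  · rw [esymm_eq_zero_of_lt (by omega), map_zero]

lemma coeff_prod_one_add_C_mul_X (h : ℕ) (c : ℚ) (k : ℕ) :
    (∏ i : Fin h, (1 + Polynomial.C (C c * X i : MvPolynomial (Fin h) ℚ) *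
      Polynomial.X)).coeff k = C c ^ k * esymm (Fin h) ℚ k := by
  rw [Finset.prod_one_add, Polynomial.finsetSum_coeff, esymm, Finset.mul_sum,
    Finset.powerset_univ, ← Finset.univ_filter_card_eq, Finset.sum_filter]
  refine Finset.sum_congr rfl fun T _ => ?_
  rw [Finset.prod_mul_distrib, Finset.prod_const, ← map_prod, Polynomial.coeff_C_mul_X_pow,
    Finset.prod_mul_distrib, Finset.prod_const]
  simp only [eq_comm (a := k)]
  split_ifs with hT
  · rw [hT]
  · rfl

lemma toEsymm_mumford {g h : ℕ} (hgh : h ≤ g) (d : ℕ) :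
    toEsymm g h (mumford g d) = ∑ T : Finset (Fin h),
      C (if 2 * T.card = d then (-1 : ℚ) ^ T.card else 0) * ∏ t ∈ T, X t ^ 2 := by
  have hprod : (∏ i : Fin h, (1 + Polynomial.C (C 1 * X i : MvPolynomial (Fin h) ℚ) *
      Polynomial.X)) * (∏ i : Fin h, (1 + Polynomial.C (C (-1) * X i : MvPolynomial (Fin h) ℚ) *
      Polynomial.X)) = ∏ i : Fin h, (1 + Polynomial.C (C (-1) * X i ^ 2 : MvPolynomial (Fin h) ℚ) *
      Polynomial.X ^ 2) := by
    rw [← Finset.prod_mul_distrib]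
    refine Finset.prod_congr rfl fun i _ => ?_
    simp only [map_mul, map_neg, map_one, map_pow]
    ring
  have hcoeff := congrArg (fun p => Polynomial.coeff p d) hprod
  simp only [Polynomial.coeff_mul, coeff_prod_one_add_C_mul_X] at hcoeff
  rw [Finset.Nat.sum_antidiagonal_eq_sum_range_succ_mk] at hcoeff
  rw [mumford, map_sum]
  calc _ = _ := Finset.sum_congr rfl fun i _ => ?_
    _ = _ := hcoeff
    _ = _ := ?_
  · rw [map_mul, map_mul, toEsymm_lam hgh, toEsymm_lam hgh]
    simp only [map_pow, map_neg, map_one]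
    ring
  · rw [Finset.prod_one_add, Polynomial.finsetSum_coeff, Finset.powerset_univ]
    refine Finset.sum_congr rfl fun T _ => ?_
    rw [Finset.prod_mul_distrib, Finset.prod_const, ← map_prod, ← pow_mul,
      Polynomial.coeff_C_mul_X_pow, Finset.prod_mul_distrib, Finset.prod_const]
    simp only [eq_comm (a := d)]
    split_ifs with hT
    · rw [map_pow]
    · simp

lemma altCoeff_toEsymm_mul_eq_zero {h : ℕ} {f : MvPolynomial (Fin (h + 1)) ℚ}
    (hf : f ∈ Rideal (h + 1)) (G : MvPolynomial (Fin h) ℚ) :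
    altCoeff h (toEsymm (h + 1) h f * G) = 0 := by
  rw [Rideal, mumfordIdeal, ← Ideal.span_union] at hf
  induction hf using Submodule.span_induction generalizing G with
  | mem f hf =>
    rcases hf with ⟨d, hd, rfl⟩ | rfl
    · rw [toEsymm_mumford h.le_succ]
      have hd1 := hd.1
      exact altCoeff_sum_prod_sq_mul (fun n => if 2 * n = d then (-1 : ℚ) ^ n else 0)
        (if_neg (by omega)) G
    · rw [toEsymm_lam h.le_succ, esymm_eq_zero_of_lt h.lt_succ_self, zero_mul, map_zero]
  | zero => simp
  | add f₁ f₂ _ _ h₁ h₂ => rw [map_add, add_mul, map_add, h₁, h₂, add_zero]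
  | smul a f _ ih => rw [smul_eq_mul, map_mul (toEsymm _ _), mul_comm (toEsymm _ _ a), mul_assoc, ih]

lemma prod_lam_notMem_Rideal_s6 (h : ℕ) :
    ∏ k ∈ Finset.range h, lam (h + 1) (k + 1) ∉ Rideal (h + 1) := fun hmem => by
  refine altCoeff_prod_esymm_ne_zero h ?_
  rw [← altCoeff_toEsymm_mul_eq_zero hmem (∏ j : Fin h, X j ^ (j : ℕ)), map_prod,
    ← Fin.prod_univ_eq_prod_range (fun k => toEsymm (h + 1) h (lam (h + 1) (k + 1)))]
  simp only [toEsymm_lam h.le_succ]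

end Evaluation

section Filtration

/-- The ideal `I_g + (λ_{n+1}, λ_{n+2}, …)`. -/
def truncIdeal (g n : ℕ) : Ideal (MvPolynomial (Fin g) ℚ) :=
  mumfordIdeal g ⊔ Ideal.span (lam g '' Set.Ioi n)

lemma lam_eq_zero_of_lt {g m : ℕ} (hm : g < m) : lam g m = 0 := by
  rw [lam, dif_neg (by omega), dif_neg (by omega)]

lemma lam_mem_truncIdeal (g : ℕ) {n m : ℕ} (hm : n < m) : lam g m ∈ truncIdeal g n :=
  Ideal.mem_sup_right (Ideal.subset_span ⟨m, hm, rfl⟩)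

lemma truncIdeal_eq_Rideal (h : ℕ) : truncIdeal (h + 1) h = Rideal (h + 1) := by
  refine le_antisymm (sup_le_sup_left (Ideal.span_le.2 ?_) _)
    (sup_le_sup_left (Ideal.span_mono ?_) _)
  · rintro _ ⟨m, hm, rfl⟩
    rcases (Nat.succ_le_of_lt hm).eq_or_lt with rfl | hlt
    · exact Ideal.subset_span rfl
    · rw [lam_eq_zero_of_lt hlt]
      exact zero_mem _
  · rintro _ rfl
    exact ⟨h + 1, h.lt_succ_self, rfl⟩

lemma truncIdeal_eq_sup_span (g n : ℕ) :
    truncIdeal g n = truncIdeal g (n + 1) ⊔ Ideal.span {lam g (n + 1)} := by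
  rw [truncIdeal, truncIdeal, sup_assoc, ← Ideal.span_union, Set.union_singleton,
    ← Set.image_insert_eq]
  congr 3
  ext m
  simp only [Set.mem_Ioi, Set.mem_insert_iff]
  omega

lemma lam_sq_mem_truncIdeal {g n : ℕ} (hn : n ≤ g) (hn0 : 1 ≤ n) :
    lam g n * lam g n ∈ truncIdeal g n := by
  have hm : mumford g (2 * n) ∈ truncIdeal g n :=
    Ideal.mem_sup_left (Ideal.subset_span ⟨2 * n, ⟨by omega, by omega⟩, rfl⟩)
  rw [mumford, ← Finset.add_sum_erase _ _ (Finset.mem_range.2 (by omega : n < 2 * n + 1)),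
    Ideal.add_mem_iff_left] at hm
  · rw [show 2 * n - n = n by omega, mul_assoc] at hm
    have := Ideal.mul_mem_left _ ((-1) ^ n) hm
    rwa [← mul_assoc, ← mul_pow, neg_one_mul, neg_neg, one_pow, one_mul] at this
  · refine Ideal.sum_mem _ fun i hi => ?_
    rw [Finset.mem_erase, Finset.mem_range] at hi
    rcases lt_or_gt_of_ne hi.1 with hlt | hlt
    · exact Ideal.mul_mem_left _ _ (lam_mem_truncIdeal g (by omega))
    · exact Ideal.mul_mem_right _ _ (Ideal.mul_mem_left _ _ (lam_mem_truncIdeal g hlt))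

/-- Modulo `I_g + (λ_{n+1}, …)`, every nonzero element has a multiple equal to the socle
generator `λ_1 ⋯ λ_n`. -/
lemma exists_mul_sub_prod_lam_mem (g n : ℕ) (hn : n ≤ g) (x : MvPolynomial (Fin g) ℚ)
    (hx : x ∉ truncIdeal g n) :
    ∃ y, x * y - ∏ k ∈ Finset.range n, lam g (k + 1) ∈ truncIdeal g n := by
  induction n generalizing x with
  | zero =>
    have hX : ∀ i : Fin g, (X i : MvPolynomial (Fin g) ℚ) ∈ truncIdeal g 0 := fun i => by
      have := lam_mem_truncIdeal g (Nat.succ_pos i)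
      rwa [lam, dif_neg (by omega), dif_pos (by omega)] at this
    have hconst : x - C (constantCoeff x) ∈ truncIdeal g 0 := by
      clear hx
      induction x using MvPolynomial.induction_on with
      | C a => simp
      | add p q hp hq =>
        rw [map_add, map_add, add_sub_add_comm]
        exact add_mem hp hq
      | mul_X p i _ => simpa using Ideal.mul_mem_left _ p (hX i)
    have hc : constantCoeff x ≠ 0 := fun hc => hx (by simpa [hc] using hconst)
    refine ⟨C (constantCoeff x)⁻¹, ?_⟩
    convert Ideal.mul_mem_right (C (constantCoeff x)⁻¹) _ hconst using 1
    rw [sub_mul, ← C_mul, mul_inv_cancel₀ hc]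
    simp
  | succ n ih =>
    have hsq := lam_sq_mem_truncIdeal hn n.succ_pos
    have lam_mul : ∀ p ∈ truncIdeal g n, lam g (n + 1) * p ∈ truncIdeal g (n + 1) := by
      intro p hp
      rw [truncIdeal_eq_sup_span, Submodule.mem_sup] at hp
      obtain ⟨a, ha, b, hb, rfl⟩ := hp
      obtain ⟨c, rfl⟩ := Ideal.mem_span_singleton'.1 hb
      rw [mul_add, mul_left_comm]
      exact add_mem (Ideal.mul_mem_left _ _ ha) (Ideal.mul_mem_left _ _ hsq)
    by_cases hxn : x ∈ truncIdeal g n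
    · rw [truncIdeal_eq_sup_span, Submodule.mem_sup] at hxn
      obtain ⟨a, ha, b, hb, rfl⟩ := hxn
      obtain ⟨c, rfl⟩ := Ideal.mem_span_singleton'.1 hb
      have hc : c ∉ truncIdeal g n := fun hc => hx <| by
        rw [mul_comm]
        exact add_mem ha (lam_mul c hc)
      obtain ⟨y, hy⟩ := ih (by omega) c hc
      refine ⟨y, ?_⟩
      convert add_mem (Ideal.mul_mem_right y _ ha) (lam_mul _ hy) using 1
      rw [Finset.prod_range_succ]
      ring
    · obtain ⟨y, hy⟩ := ih (by omega) x hxn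
      refine ⟨lam g (n + 1) * y, ?_⟩
      convert lam_mul _ hy using 1
      rw [Finset.prod_range_succ]
      ring

end Filtration

section Grading

lemma isWeightedHomogeneous_prod_lam (g h : ℕ) :
    IsWeightedHomogeneous (fun i : Fin g => (i : ℕ) + 1)
      (∏ k ∈ Finset.range h, lam g (k + 1)) ((h + 1) * h / 2) := by
  convert IsWeightedHomogeneous.prod (Finset.range h) (fun k => lam g (k + 1)) (fun k => k + 1)
    fun k _ => isWeightedHomogeneous_lam g (k + 1) using 1
  have := Finset.sum_range_id_mul_two (h + 1)
  rw [Finset.sum_range_succ'] at this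
  simp only [Nat.add_sub_cancel] at this
  omega

attribute [local instance] MvPolynomial.weightedGradedAlgebra

lemma Rideal_isHomogeneous (g : ℕ) : (Rideal g).IsHomogeneous
    (weightedHomogeneousSubmodule ℚ fun i : Fin g => (i : ℕ) + 1) := by
  rw [Rideal, mumfordIdeal, ← Ideal.span_union]
  refine Ideal.homogeneous_span _ _ ?_
  rintro _ (⟨d, _, rfl⟩ | rfl)
  · exact ⟨d, isWeightedHomogeneous_mumford g d⟩
  · exact ⟨g, isWeightedHomogeneous_lam g g⟩

lemma exists_homogR_mul_ne_zero {g : ℕ} (hg : 1 ≤ g) {k : ℕ} (hk : k ≤ g * (g - 1) / 2)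
    {x : Rring g} (hx : x ∈ homogR g k) (hx0 : x ≠ 0) :
    ∃ y ∈ homogR g (g * (g - 1) / 2 - k), x * y ≠ 0 := by
  obtain ⟨h, rfl⟩ : ∃ h, g = h + 1 := ⟨g - 1, by omega⟩
  rw [Nat.add_sub_cancel] at hk ⊢
  obtain ⟨f, hf, rfl⟩ := hx
  have hfI : f ∉ Rideal (h + 1) := fun hmem => hx0 (Ideal.Quotient.eq_zero_iff_mem.2 hmem)
  rw [← truncIdeal_eq_Rideal] at hfI
  obtain ⟨y, hy⟩ := exists_mul_sub_prod_lam_mem (h + 1) h h.le_succ f hfI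
  rw [truncIdeal_eq_Rideal] at hy
  set 𝒜 := weightedHomogeneousSubmodule ℚ fun i : Fin (h + 1) => (i : ℕ) + 1
  have hcomp := Rideal_isHomogeneous (h + 1) ((h + 1) * h / 2) hy
  rw [DirectSum.decompose_sub, DirectSum.sub_apply, AddSubgroupClass.coe_sub,
    DirectSum.coe_decompose_mul_of_left_mem_of_le 𝒜 hf hk,
    DirectSum.decompose_of_mem_same 𝒜 (isWeightedHomogeneous_prod_lam (h + 1) h)] at hcomp
  refine ⟨_, ⟨DirectSum.decompose 𝒜 y ((h + 1) * h / 2 - k), SetLike.coe_mem _, rfl⟩, fun h0 => ?_⟩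
  have hmem : f * DirectSum.decompose 𝒜 y ((h + 1) * h / 2 - k) ∈ Rideal (h + 1) :=
    Ideal.Quotient.eq_zero_iff_mem.1 h0
  exact prod_lam_notMem_Rideal_s6 h (by simpa using sub_mem hmem hcomp)

end Grading

/-- **ℛ_g is Gorenstein with socle in degree g(g−1)/2 (van der Geer).**
For `0 ≤ k ≤ g(g−1)/2`, the multiplication pairing between the degree-`k` and
degree-`(g(g−1)/2 − k)` graded pieces of `ℛ_g` is perfect: every nonzero
homogeneous element of degree `k` pairs nontrivially with some homogeneous element
of the complementary degree, and symmetrically. -/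
theorem Rring_gorenstein (g : ℕ) (hg : 1 ≤ g) (k : ℕ) (hk : k ≤ g * (g - 1) / 2) :
    (∀ x ∈ homogR g k, x ≠ 0 →
      ∃ y ∈ homogR g (g * (g - 1) / 2 - k), x * y ≠ 0) ∧
    (∀ y ∈ homogR g (g * (g - 1) / 2 - k), y ≠ 0 →
      ∃ x ∈ homogR g k, x * y ≠ 0) := by
  refine ⟨fun x hx hx0 => exists_homogR_mul_ne_zero hg hk hx hx0, fun y hy hy0 => ?_⟩
  obtain ⟨x, hx, hxy⟩ := exists_homogR_mul_ne_zero hg (Nat.sub_le _ k) hy hy0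
  rw [Nat.sub_sub_self hk] at hx
  exact ⟨x, hx, mul_comm y x ▸ hxy⟩

end
end

section
/- In ℚ[z_1,z_2,z_3,z_4,z_5,ℓ_1,ℓ_2] let c := (1+z_1+z_2+z_4)(1+z_1+z_2+z_5)(1+z_1+z_3)(1+ℓ_1)(1+ℓ_2), and set R_4 := −3·[c]_2 + [c]_1·(6z_1+4z_2+4z_3) − 10z_1² − 10z_1(z_2+z_3) − 5(z_2+z_3)² + 5z_2z_3, R_5 := −4·[c]_1 + 10z_1 + 5(z_3+z_4+z_5), and R_6 := −3·[c]_1 + 6z_2 + 3z_3 + 4(z_4+z_5). Then [c]_5 = 15·z_1z_2z_3z_4z_5 + z_1·[c/(1+z_1)]_4 + z_2z_3·[c/((1+z_2)(1+z_3))]_3 + z_3z_4z_5·[c/((1+z_3)(1+z_4)(1+z_5))]_2 + z_1z_2z_3·R_4 + z_1z_3z_4z_5·R_5 + z_2z_3z_4z_5·R_6. -/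
open MvPolynomial

/-- The truncated geometric series `Σ_{t=0}^{d} (−w)^t`, so that the degree-`d`
homogeneous component of `P * geom d w` is the degree-`d` component of the power
series expansion `P/(1+w)`. -/
noncomputable def geom {σ : Type*} (d : ℕ) (w : MvPolynomial σ ℚ) : MvPolynomial σ ℚ :=
  ∑ t ∈ Finset.range (d + 1), (-w) ^ t

namespace MvPolynomial

variable {σ : Type*}

lemma homogeneousComponent_succ_mul {R : Type*} [CommSemiring R] {w : MvPolynomial σ R}
    (hw : w.IsHomogeneous 1) (P : MvPolynomial σ R) (d : ℕ) :
    homogeneousComponent (d + 1) (P * w) = homogeneousComponent d P * w := by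
  conv_lhs => rw [← sum_homogeneousComponent P, Finset.sum_mul, map_sum]
  have h (i : ℕ) : homogeneousComponent (d + 1) (homogeneousComponent i P * w) =
      if i = d then homogeneousComponent d P * w else 0 := by
    rw [homogeneousComponent_of_mem (m := d + 1)
      ((mem_homogeneousSubmodule (i + 1) _).2 ((homogeneousComponent_isHomogeneous i P).mul hw))]
    by_cases hid : i = d
    · simp [hid]
    · rw [if_neg (by omega), if_neg hid]
  simp_rw [h]
  rw [Finset.sum_ite_eq']
  split_ifs with hd
  · rfl
  · rw [homogeneousComponent_eq_zero d P (by simpa using hd), zero_mul]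

lemma homogeneousComponent_zero_mul {R : Type*} [CommSemiring R] {w : MvPolynomial σ R}
    (hw : w.IsHomogeneous 1) (P : MvPolynomial σ R) :
    homogeneousComponent 0 (P * w) = 0 := by
  rw [homogeneousComponent_zero, ← constantCoeff_eq, map_mul, constantCoeff_eq,
    hw.coeff_eq_zero (by simp), mul_zero, C_0]

lemma homogeneousComponent_succ_mul_one_add {R : Type*} [CommSemiring R] {w : MvPolynomial σ R}
    (hw : w.IsHomogeneous 1) (P : MvPolynomial σ R) (d : ℕ) :
    homogeneousComponent (d + 1) (P * (1 + w)) =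
      homogeneousComponent (d + 1) P + homogeneousComponent d P * w := by
  rw [mul_add, mul_one, map_add, homogeneousComponent_succ_mul hw]

lemma homogeneousComponent_zero_mul_one_add {R : Type*} [CommSemiring R] {w : MvPolynomial σ R}
    (hw : w.IsHomogeneous 1) (P : MvPolynomial σ R) :
    homogeneousComponent 0 (P * (1 + w)) = homogeneousComponent 0 P := by
  rw [mul_add, mul_one, map_add, homogeneousComponent_zero_mul hw, add_zero]

lemma homogeneousComponent_succ_one {R : Type*} [CommSemiring R] (d : ℕ) :
    homogeneousComponent (d + 1) (1 : MvPolynomial σ R) = 0 :=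
  homogeneousComponent_eq_zero _ _ (by simp)

lemma homogeneousComponent_zero_one {R : Type*} [CommSemiring R] :
    homogeneousComponent 0 (1 : MvPolynomial σ R) = 1 := by
  simp [homogeneousComponent_zero]

lemma geom_zero (w : MvPolynomial σ ℚ) : geom 0 w = 1 := by
  simp [geom]

lemma geom_succ (n : ℕ) (w : MvPolynomial σ ℚ) : geom (n + 1) w = 1 - geom n w * w := by
  rw [geom, Finset.sum_range_succ', geom, Finset.sum_mul, pow_zero, sub_eq_neg_add,
    ← Finset.sum_neg_distrib]
  simp only [pow_succ, mul_neg]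

lemma homogeneousComponent_succ_mul_geom_succ {w : MvPolynomial σ ℚ} (hw : w.IsHomogeneous 1)
    (P : MvPolynomial σ ℚ) (d n : ℕ) :
    homogeneousComponent (d + 1) (P * geom (n + 1) w) =
      homogeneousComponent (d + 1) P - homogeneousComponent d (P * geom n w) * w := by
  rw [geom_succ, mul_sub, mul_one, map_sub, ← mul_assoc, homogeneousComponent_succ_mul hw]

lemma homogeneousComponent_zero_mul_geom {w : MvPolynomial σ ℚ} (hw : w.IsHomogeneous 1)
    (P : MvPolynomial σ ℚ) (n : ℕ) :
    homogeneousComponent 0 (P * geom n w) = homogeneousComponent 0 P := by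
  cases n with
  | zero => rw [geom_zero, mul_one]
  | succ n =>
    rw [geom_succ, mul_sub, mul_one, map_sub, ← mul_assoc, homogeneousComponent_zero_mul hw,
      sub_zero]

end MvPolynomial

/-- **Example 5.5: the depth-2 extremal tree for g = 6 has contribution 15.**
In `ℚ[z_1,…,z_5,ℓ_1,ℓ_2]` with
`c = (1+z_1+z_2+z_4)(1+z_1+z_2+z_5)(1+z_1+z_3)(1+ℓ_1)(1+ℓ_2)` and the smoothing
contributions `R_4`, `R_5`, `R_6` as given, one has
`[c]_5 = 15·z_1z_2z_3z_4z_5 + z_1·[c/(1+z_1)]_4 + z_2z_3·[c/((1+z_2)(1+z_3))]_3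
  + z_3z_4z_5·[c/((1+z_3)(1+z_4)(1+z_5))]_2 + z_1z_2z_3·R_4 + z_1z_3z_4z_5·R_5
  + z_2z_3z_4z_5·R_6`. -/
theorem excess_contribution_g6_depth_two :
    let z1 : MvPolynomial (Fin 7) ℚ := X 0
    let z2 : MvPolynomial (Fin 7) ℚ := X 1
    let z3 : MvPolynomial (Fin 7) ℚ := X 2
    let z4 : MvPolynomial (Fin 7) ℚ := X 3
    let z5 : MvPolynomial (Fin 7) ℚ := X 4
    let l1 : MvPolynomial (Fin 7) ℚ := X 5
    let l2 : MvPolynomial (Fin 7) ℚ := X 6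
    let c := (1 + z1 + z2 + z4) * (1 + z1 + z2 + z5) * (1 + z1 + z3)
              * (1 + l1) * (1 + l2)
    let R4 := -3 * homogeneousComponent 2 c
                + homogeneousComponent 1 c * (6 * z1 + 4 * z2 + 4 * z3)
                - 10 * z1 ^ 2 - 10 * z1 * (z2 + z3) - 5 * (z2 + z3) ^ 2 + 5 * z2 * z3
    let R5 := -4 * homogeneousComponent 1 c + 10 * z1 + 5 * (z3 + z4 + z5)
    let R6 := -3 * homogeneousComponent 1 c + 6 * z2 + 3 * z3 + 4 * (z4 + z5)
    homogeneousComponent 5 c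
      = 15 * (z1 * z2 * z3 * z4 * z5)
        + z1 * homogeneousComponent 4 (c * geom 4 z1)
        + z2 * z3 * homogeneousComponent 3 (c * geom 3 z2 * geom 3 z3)
        + z3 * z4 * z5 * homogeneousComponent 2 (c * geom 2 z3 * geom 2 z4 * geom 2 z5)
        + z1 * z2 * z3 * R4
        + z1 * z3 * z4 * z5 * R5
        + z2 * z3 * z4 * z5 * R6 := by
  intro z1 z2 z3 z4 z5 l1 l2 c R4 R5 R6
  have hz1 : z1.IsHomogeneous 1 := isHomogeneous_X _ _
  have hz2 : z2.IsHomogeneous 1 := isHomogeneous_X _ _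
  have hz3 : z3.IsHomogeneous 1 := isHomogeneous_X _ _
  have hz4 : z4.IsHomogeneous 1 := isHomogeneous_X _ _
  have hz5 : z5.IsHomogeneous 1 := isHomogeneous_X _ _
  have hl1 : l1.IsHomogeneous 1 := isHomogeneous_X _ _
  have hl2 : l2.IsHomogeneous 1 := isHomogeneous_X _ _
  have ha : (z1 + z2 + z4).IsHomogeneous 1 := (hz1.add hz2).add hz4
  have hb : (z1 + z2 + z5).IsHomogeneous 1 := (hz1.add hz2).add hz5
  have he : (z1 + z3).IsHomogeneous 1 := hz1.add hz3
  have hc : c = 1 * (1 + (z1 + z2 + z4)) * (1 + (z1 + z2 + z5)) * (1 + (z1 + z3))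
      * (1 + l1) * (1 + l2) := by
    simp only [c, one_mul, add_assoc]
  have hc0 : homogeneousComponent 0 c = 1 := by
    rw [hc]
    simp only [homogeneousComponent_zero_mul_one_add, homogeneousComponent_zero_one, ha, hb, he, hl1, hl2]
  simp only [R4, R5, R6, homogeneousComponent_succ_mul_geom_succ,
    homogeneousComponent_zero_mul_geom, geom_zero, mul_one, hz1, hz2, hz3, hz4, hz5, hc0]
  clear_value R4 R5 R6
  rw [hc]
  clear_value c z1 z2 z3 z4 z5 l1 l2
  simp only [homogeneousComponent_succ_mul_one_add, homogeneousComponent_zero_mul_one_add,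
    homogeneousComponent_succ_one, homogeneousComponent_zero_one, ha, hb, he, hl1, hl2]
  ring
end
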